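/- arXiv:1707.05446 — 2 statements merged into one kernel-verified Lean document; each statement's English description precedes it below -/
import Mathlib

section
/- Let U and U₁ be n×n real orthogonal matrices, V and V₁ be m×m real orthogonal matrices, and let Σ and Σ₁ be n×m matrices that are zero off the main diagonal with nonnegative diagonal entries arranged in nonincreasing order (σ_1 ≥ σ_2 ≥ … ≥ 0 and s_1 ≥ s_2 ≥ … ≥ 0, respectively). Then Tr(V Σᵀ Uᵀ U₁ Σ₁ V₁ᵀ) ≤ Tr(Σᵀ Σ₁) = Σ_i σ_i s_i, and equality holds in particular when U = U₁ and V = V₁. -/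
open Matrix BigOperators

/-- Entrywise squares of an orthogonal matrix form a doubly stochastic matrix. -/
lemma sq_entries_mem_doublyStochastic {k : ℕ} {P : Matrix (Fin k) (Fin k) ℝ}
    (hP : Pᵀ * P = 1) : (Matrix.of fun a b => P a b ^ 2) ∈ doublyStochastic ℝ (Fin k) := by
  have hP' : P * Pᵀ = 1 := mul_eq_one_comm.mp hP
  rw [mem_doublyStochastic_iff_sum]
  refine ⟨fun a b => sq_nonneg _, fun a => ?_, fun b => ?_⟩
  · simpa [Matrix.mul_apply, sq] using congrFun (congrFun hP' a) a
  · simpa [Matrix.mul_apply, sq] using congrFun (congrFun hP b) b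

/-- The rearrangement inequality for doubly stochastic weights. -/
lemma sum_mul_mul_le_of_mem_doublyStochastic {k : ℕ} {M : Matrix (Fin k) (Fin k) ℝ}
    (hM : M ∈ doublyStochastic ℝ (Fin k)) {f g : Fin k → ℝ} (hfg : Monovary f g) :
    ∑ a, ∑ b, f a * g b * M a b ≤ ∑ a, f a * g a := by
  obtain ⟨w, hw, hw1, rfl⟩ := exists_eq_sum_perm_of_mem_doublyStochastic hM
  calc ∑ a, ∑ b, f a * g b * (∑ τ, w τ • τ.permMatrix ℝ) a b
      = ∑ a, ∑ b, ∑ τ : Equiv.Perm (Fin k), w τ * (f a * g b * τ.permMatrix ℝ a b) := by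
        refine Finset.sum_congr rfl fun a _ => Finset.sum_congr rfl fun b _ => ?_
        rw [Matrix.sum_apply, Finset.mul_sum]
        refine Finset.sum_congr rfl fun τ _ => ?_
        rw [Matrix.smul_apply, smul_eq_mul]
        ring
    _ = ∑ τ : Equiv.Perm (Fin k), w τ * ∑ a, f a * g (τ a) := by
        rw [Finset.sum_congr rfl fun a _ => Finset.sum_comm, Finset.sum_comm]
        refine Finset.sum_congr rfl fun τ _ => ?_
        rw [Finset.mul_sum]
        refine Finset.sum_congr rfl fun a _ => ?_
        simp [Equiv.Perm.permMatrix, PEquiv.toMatrix_apply, Equiv.toPEquiv_apply]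
    _ ≤ ∑ τ : Equiv.Perm (Fin k), w τ * ∑ a, f a * g a :=
        Finset.sum_le_sum fun τ _ =>
          mul_le_mul_of_nonneg_left hfg.sum_mul_comp_perm_le_sum_mul (hw τ)
    _ = ∑ a, f a * g a := by rw [← Finset.sum_mul, hw1, one_mul]

section DiagonalRectangular

variable {n m : ℕ} {S S₁ : Matrix (Fin n) (Fin m) ℝ}

lemma row_sum_eq_of_off_diag_eq_zero
    (hS : ∀ (i : Fin n) (j : Fin m), (i : ℕ) ≠ (j : ℕ) → S i j = 0) (i : Fin n) :
    ∑ j, S i j = if h : (i : ℕ) < m then S i ⟨i, h⟩ else 0 := by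
  split_ifs with h
  · exact Fintype.sum_eq_single _ fun j hj => hS i j fun hij => hj (Fin.ext hij.symm)
  · exact Finset.sum_eq_zero fun j _ => hS i j fun hij => h (hij ▸ j.isLt)

lemma antitone_row_sum
    (hS : ∀ (i : Fin n) (j : Fin m), (i : ℕ) ≠ (j : ℕ) → S i j = 0)
    (hnn : ∀ (i : Fin n) (j : Fin m), (i : ℕ) = (j : ℕ) → 0 ≤ S i j)
    (hmono : ∀ (i i' : Fin n) (j j' : Fin m), (i : ℕ) = (j : ℕ) → (i' : ℕ) = (j' : ℕ) →
      (i : ℕ) ≤ (i' : ℕ) → S i' j' ≤ S i j) :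
    Antitone fun i => ∑ j, S i j := by
  intro i i' hii'
  have hle : (i : ℕ) ≤ (i' : ℕ) := hii'
  simp only [row_sum_eq_of_off_diag_eq_zero hS]
  split_ifs with h' h h
  · exact hmono _ _ _ _ rfl rfl hle
  · omega
  · exact hnn _ _ rfl
  · exact le_rfl

lemma trace_transpose_mul_eq_sum_row_sum
    (hS : ∀ (i : Fin n) (j : Fin m), (i : ℕ) ≠ (j : ℕ) → S i j = 0)
    (hS₁ : ∀ (i : Fin n) (j : Fin m), (i : ℕ) ≠ (j : ℕ) → S₁ i j = 0) :
    (Sᵀ * S₁).trace = ∑ i, (∑ j, S i j) * ∑ j, S₁ i j := by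
  simp only [Matrix.trace, Matrix.diag_apply, Matrix.mul_apply, Matrix.transpose_apply]
  rw [Finset.sum_comm]
  refine Finset.sum_congr rfl fun i _ => ?_
  rw [Finset.sum_mul]
  refine Finset.sum_congr rfl fun j _ => ?_
  by_cases hij : (i : ℕ) = (j : ℕ)
  · rw [Fintype.sum_eq_single j fun j' hj' => hS₁ i j' fun h => hj' (Fin.ext (h.symm.trans hij))]
  · simp [hS i j hij]

/-- The contribution of the squared entries of the left orthogonal factor. -/
lemma sum_row_sum_mul_sq_le_trace
    (hSoff : ∀ (i : Fin n) (j : Fin m), (i : ℕ) ≠ (j : ℕ) → S i j = 0)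
    (hS₁off : ∀ (i : Fin n) (j : Fin m), (i : ℕ) ≠ (j : ℕ) → S₁ i j = 0)
    (hSnn : ∀ (i : Fin n) (j : Fin m), (i : ℕ) = (j : ℕ) → 0 ≤ S i j)
    (hS₁nn : ∀ (i : Fin n) (j : Fin m), (i : ℕ) = (j : ℕ) → 0 ≤ S₁ i j)
    (hSmono : ∀ (i i' : Fin n) (j j' : Fin m), (i : ℕ) = (j : ℕ) → (i' : ℕ) = (j' : ℕ) →
      (i : ℕ) ≤ (i' : ℕ) → S i' j' ≤ S i j)
    (hS₁mono : ∀ (i i' : Fin n) (j j' : Fin m), (i : ℕ) = (j : ℕ) → (i' : ℕ) = (j' : ℕ) →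
      (i : ℕ) ≤ (i' : ℕ) → S₁ i' j' ≤ S₁ i j)
    {P : Matrix (Fin n) (Fin n) ℝ} (hP : Pᵀ * P = 1) :
    ∑ i, ∑ i', (∑ j, S i j) * (∑ j', S₁ i' j') * P i i' ^ 2 ≤ (Sᵀ * S₁).trace := by
  rw [trace_transpose_mul_eq_sum_row_sum hSoff hS₁off]
  exact sum_mul_mul_le_of_mem_doublyStochastic (sq_entries_mem_doublyStochastic hP)
    ((antitone_row_sum hSoff hSnn hSmono).monovary (antitone_row_sum hS₁off hS₁nn hS₁mono))

lemma trace_transpose_mul_mul_mul_eq_sum (P : Matrix (Fin n) (Fin n) ℝ)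
    (Q : Matrix (Fin m) (Fin m) ℝ) :
    (Sᵀ * P * S₁ * Q).trace =
      ∑ i, ∑ i', ∑ j, ∑ j', S i j * S₁ i' j' * (P i i' * Q j' j) := by
  simp only [Matrix.trace, Matrix.diag_apply, Matrix.mul_apply, Matrix.transpose_apply,
    Finset.sum_mul]
  have h : ∀ j : Fin m, (∑ j' : Fin m, ∑ i' : Fin n, ∑ i : Fin n,
      S i j * P i i' * S₁ i' j' * Q j' j) =
      ∑ i, ∑ i', ∑ j', S i j * S₁ i' j' * (P i i' * Q j' j) := by
    intro j
    rw [Finset.sum_comm, Finset.sum_congr rfl fun i' _ => Finset.sum_comm, Finset.sum_comm]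
    refine Finset.sum_congr rfl fun i _ => Finset.sum_congr rfl fun i' _ =>
      Finset.sum_congr rfl fun j' _ => by ring
  rw [Finset.sum_congr rfl fun j _ => h j, Finset.sum_comm]
  exact Finset.sum_congr rfl fun i _ => Finset.sum_comm

lemma trace_transpose_mul_mul_mul_le (hSnn : ∀ i j, 0 ≤ S i j) (hS₁nn : ∀ i j, 0 ≤ S₁ i j)
    (P : Matrix (Fin n) (Fin n) ℝ) (Q : Matrix (Fin m) (Fin m) ℝ) :
    (Sᵀ * P * S₁ * Q).trace ≤
      ((∑ i, ∑ i', (∑ j, S i j) * (∑ j', S₁ i' j') * P i i' ^ 2) +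
        ∑ j, ∑ j', (∑ i, S i j) * (∑ i', S₁ i' j') * Qᵀ j j' ^ 2) / 2 := by
  have hrow : ∑ i, ∑ i', (∑ j, S i j) * (∑ j', S₁ i' j') * P i i' ^ 2 =
      ∑ i, ∑ i', ∑ j, ∑ j', S i j * S₁ i' j' * P i i' ^ 2 := by
    simp only [Finset.sum_mul_sum]
    simp only [Finset.sum_mul]
  have hcol : ∑ j, ∑ j', (∑ i, S i j) * (∑ i', S₁ i' j') * Qᵀ j j' ^ 2 =
      ∑ i, ∑ i', ∑ j, ∑ j', S i j * S₁ i' j' * Q j' j ^ 2 := by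
    simp only [Finset.sum_mul_sum]
    simp only [Finset.sum_mul, Matrix.transpose_apply]
    simp only [← Fintype.sum_prod_type' (α₁ := Fin n) (α₂ := Fin n),
      ← Fintype.sum_prod_type' (α₁ := Fin m) (α₂ := Fin m)]
    exact Finset.sum_comm
  rw [trace_transpose_mul_mul_mul_eq_sum, hrow, hcol]
  simp only [← Finset.sum_add_distrib, Finset.sum_div]
  gcongr with i _ i' _ j _ j' _
  nlinarith [mul_nonneg (mul_nonneg (hSnn i j) (hS₁nn i' j')) (sq_nonneg (P i i' - Q j' j))]

end DiagonalRectangular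

/-- Von Neumann–Mirsky trace inequality: for orthogonal `U, U₁` (n×n) and `V, V₁` (m×m)
and `n×m` matrices `S, S₁` vanishing off the main diagonal with nonnegative nonincreasing
diagonal entries, `Tr(V Sᵀ Uᵀ U₁ S₁ V₁ᵀ) ≤ Tr(Sᵀ S₁) = ∑ᵢ σᵢ sᵢ`, with equality when
`U = U₁` and `V = V₁`. -/
theorem von_neumann_trace_inequality {n m : ℕ}
    (U U₁ : Matrix (Fin n) (Fin n) ℝ) (V V₁ : Matrix (Fin m) (Fin m) ℝ)
    (hU : Uᵀ * U = 1) (hU₁ : U₁ᵀ * U₁ = 1) (hV : Vᵀ * V = 1) (hV₁ : V₁ᵀ * V₁ = 1)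
    (S S₁ : Matrix (Fin n) (Fin m) ℝ)
    (hSoff : ∀ (i : Fin n) (j : Fin m), (i : ℕ) ≠ (j : ℕ) → S i j = 0)
    (hS₁off : ∀ (i : Fin n) (j : Fin m), (i : ℕ) ≠ (j : ℕ) → S₁ i j = 0)
    (hSnn : ∀ (i : Fin n) (j : Fin m), (i : ℕ) = (j : ℕ) → 0 ≤ S i j)
    (hS₁nn : ∀ (i : Fin n) (j : Fin m), (i : ℕ) = (j : ℕ) → 0 ≤ S₁ i j)
    (hSmono : ∀ (i i' : Fin n) (j j' : Fin m), (i : ℕ) = (j : ℕ) → (i' : ℕ) = (j' : ℕ) →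
      (i : ℕ) ≤ (i' : ℕ) → S i' j' ≤ S i j)
    (hS₁mono : ∀ (i i' : Fin n) (j j' : Fin m), (i : ℕ) = (j : ℕ) → (i' : ℕ) = (j' : ℕ) →
      (i : ℕ) ≤ (i' : ℕ) → S₁ i' j' ≤ S₁ i j) :
    (V * Sᵀ * Uᵀ * U₁ * S₁ * V₁ᵀ).trace ≤ (Sᵀ * S₁).trace ∧
    ((Sᵀ * S₁).trace =
      ∑ j : Fin m, if h : (j : ℕ) < n then S ⟨j, h⟩ j * S₁ ⟨j, h⟩ j else 0) ∧
    (U = U₁ → V = V₁ → (V * Sᵀ * Uᵀ * U₁ * S₁ * V₁ᵀ).trace = (Sᵀ * S₁).trace) := by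
  have nonneg : ∀ {T : Matrix (Fin n) (Fin m) ℝ},
      (∀ (i : Fin n) (j : Fin m), (i : ℕ) ≠ (j : ℕ) → T i j = 0) →
      (∀ (i : Fin n) (j : Fin m), (i : ℕ) = (j : ℕ) → 0 ≤ T i j) → ∀ i j, 0 ≤ T i j :=
    fun hoff hnn i j => (eq_or_ne (i : ℕ) (j : ℕ)).elim (hnn i j) fun h => (hoff i j h).ge
  have cycle : (V * Sᵀ * Uᵀ * U₁ * S₁ * V₁ᵀ).trace = (Sᵀ * (Uᵀ * U₁) * S₁ * (V₁ᵀ * V)).trace := by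
    simp only [Matrix.mul_assoc]
    rw [Matrix.trace_mul_comm]
    simp only [Matrix.mul_assoc]
  refine ⟨?_, ?_, ?_⟩
  · have hP : (Uᵀ * U₁)ᵀ * (Uᵀ * U₁) = 1 := by
      rw [Matrix.transpose_mul, Matrix.transpose_transpose, Matrix.mul_assoc,
        ← Matrix.mul_assoc U, mul_eq_one_comm.mp hU, Matrix.one_mul, hU₁]
    have hQ : (V₁ᵀ * V)ᵀᵀ * (V₁ᵀ * V)ᵀ = 1 := by
      rw [Matrix.transpose_transpose, Matrix.transpose_mul, Matrix.transpose_transpose,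
        Matrix.mul_assoc, ← Matrix.mul_assoc V, mul_eq_one_comm.mp hV, Matrix.one_mul, hV₁]
    have hrow := sum_row_sum_mul_sq_le_trace hSoff hS₁off hSnn hS₁nn hSmono hS₁mono hP
    have hcol := sum_row_sum_mul_sq_le_trace (S := Sᵀ) (S₁ := S₁ᵀ)
      (fun j i h => hSoff i j h.symm) (fun j i h => hS₁off i j h.symm)
      (fun j i h => hSnn i j h.symm) (fun j i h => hS₁nn i j h.symm)
      (fun j j' i i' h h' hle => hSmono i i' j j' h.symm h'.symm (by omega))
      (fun j j' i i' h h' hle => hS₁mono i i' j j' h.symm h'.symm (by omega)) hQ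
    have htrace : (Sᵀᵀ * S₁ᵀ).trace = (Sᵀ * S₁).trace := by
      rw [← Matrix.transpose_mul, Matrix.trace_transpose, Matrix.trace_mul_comm]
    rw [htrace] at hcol
    have hle := trace_transpose_mul_mul_mul_le (nonneg hSoff hSnn) (nonneg hS₁off hS₁nn)
      (Uᵀ * U₁) (V₁ᵀ * V)
    simp only [Matrix.transpose_apply S, Matrix.transpose_apply S₁] at hcol
    rw [cycle]
    linarith
  · simp only [Matrix.trace, Matrix.diag_apply, Matrix.mul_apply, Matrix.transpose_apply]
    refine Finset.sum_congr rfl fun j _ => ?_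
    split_ifs with h
    · exact Fintype.sum_eq_single _ fun i hi => by
        rw [hSoff i j fun hij => hi (Fin.ext hij), zero_mul]
    · exact Finset.sum_eq_zero fun i _ => by
        rw [hSoff i j fun hij => h (hij ▸ i.isLt), zero_mul]
  · rintro rfl rfl
    rw [cycle, hU, hV, Matrix.mul_one, Matrix.mul_one]
end

section
/- Let v ∈ ℝ^K. Then there exists a real number ν such that the vector q with entries q(j) = max(v(j) − ν, 0) satisfies Σ_{j=1}^K q(j) = 1, and this q is the Euclidean projection of v onto the simplex Δ^{K−1}: for every w ∈ ℝ^K with nonnegative entries summing to 1, ‖v − q‖₂ ≤ ‖v − w‖₂, with equality only when w = q. -/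
open BigOperators

/-- The truncated sum `∑ max (v j - ν) 0` attains the value `1`. -/
theorem exists_sum_max_sub_eq_one {ι : Type*} [Fintype ι] [Nonempty ι] (v : ι → ℝ) :
    ∃ ν : ℝ, ∑ j, max (v j - ν) 0 = 1 := by
  refine mem_range_of_exists_le_of_exists_ge (f := fun ν : ℝ ↦ ∑ j, max (v j - ν) 0)
    (by fun_prop) ⟨∑ j, |v j|, ?_⟩ ?_
  · refine (Finset.sum_nonpos fun j _ ↦ max_le ?_ le_rfl).trans zero_le_one
    have := Finset.single_le_sum (f := fun j ↦ |v j|) (fun i _ ↦ abs_nonneg _) (Finset.mem_univ j)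
    linarith [le_abs_self (v j)]
  · obtain ⟨i⟩ := ‹Nonempty ι›
    refine ⟨v i - 1, le_trans ?_ (Finset.single_le_sum
      (f := fun j ↦ max (v j - (v i - 1)) 0) (fun j _ ↦ le_max_right _ _) (Finset.mem_univ i))⟩
    simp

/-- Scalar variational inequality for soft thresholding at level `ν`. -/
theorem sq_sub_max_add_le {a w : ℝ} (ν : ℝ) (hw : 0 ≤ w) :
    (a - max (a - ν) 0) ^ 2 + (w - max (a - ν) 0) ^ 2 + 2 * ν * (max (a - ν) 0 - w)
      ≤ (a - w) ^ 2 := by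
  rcases le_total (a - ν) 0 with h | h
  · rw [max_eq_right h]
    nlinarith [mul_nonneg (neg_nonneg.2 h) hw]
  · rw [max_eq_left h]
    nlinarith

/-- Pythagorean inequality for the thresholded vector. -/
theorem norm_sub_sq_add_norm_sub_sq_le {ι : Type*} [Fintype ι] {v q w : EuclideanSpace ℝ ι}
    {ν : ℝ} (hq : ∀ j, q j = max (v j - ν) 0) (hw : ∀ j, 0 ≤ w j)
    (hsum : ∑ j, q j = ∑ j, w j) :
    ‖v - q‖ ^ 2 + ‖w - q‖ ^ 2 ≤ ‖v - w‖ ^ 2 := by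
  have h := Finset.sum_le_sum fun j (_ : j ∈ Finset.univ) ↦ sq_sub_max_add_le (a := v j) ν (hw j)
  simp only [← hq, Finset.sum_add_distrib, ← Finset.mul_sum, Finset.sum_sub_distrib, hsum,
    sub_self, mul_zero, add_zero] at h
  simpa [EuclideanSpace.real_norm_sq_eq] using h

/-- Projection onto the simplex: for any `v ∈ ℝ^K` (with `K ≥ 1` so that the simplex
`Δ^{K−1}` is nonempty), there is a threshold `ν` such that `q(j) = max(v(j) − ν, 0)`
sums to 1, and this `q` is the Euclidean projection of `v` onto the simplex: for every
`w` with nonnegative entries summing to 1, `‖v − q‖₂ ≤ ‖v − w‖₂`, with equality only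
when `w = q`. -/
theorem simplex_projection_threshold {K : ℕ} (hK : 0 < K)
    (v : EuclideanSpace ℝ (Fin K)) :
    ∃ (ν : ℝ) (q : EuclideanSpace ℝ (Fin K)),
      (∀ j, q j = max (v j - ν) 0) ∧
      (∑ j, q j) = 1 ∧
      ∀ w : EuclideanSpace ℝ (Fin K), (∀ j, 0 ≤ w j) → (∑ j, w j) = 1 →
        ‖v - q‖ ≤ ‖v - w‖ ∧ (‖v - q‖ = ‖v - w‖ → w = q) := by
  have : Nonempty (Fin K) := ⟨⟨0, hK⟩⟩
  obtain ⟨ν, hν⟩ := exists_sum_max_sub_eq_one v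
  refine ⟨ν, WithLp.toLp 2 fun j ↦ max (v j - ν) 0, fun _ ↦ rfl, hν, fun w hw hw1 ↦ ?_⟩
  have h := norm_sub_sq_add_norm_sub_sq_le (v := v)
    (q := WithLp.toLp 2 fun j ↦ max (v j - ν) 0) (fun _ ↦ rfl) hw (hν.trans hw1.symm)
  refine ⟨pow_le_pow_iff_left₀ (norm_nonneg _) (norm_nonneg _) two_ne_zero |>.1 ?_,
    fun heq ↦ ?_⟩
  · linarith [sq_nonneg ‖w - WithLp.toLp 2 fun j ↦ max (v j - ν) 0‖]
  · rw [heq] at h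
    exact sub_eq_zero.1 (norm_eq_zero.1 (pow_eq_zero_iff two_ne_zero |>.1
      (le_antisymm (by linarith) (sq_nonneg _))))
end
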